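/- Let E be an aperiodic countable Borel equivalence relation on a standard Borel space X. Then there is a smooth Borel equivalence relation F on X such that E ∩ F is aperiodic and hyperfinite. -/

import Mathlib

open MeasureTheory

/-- `E` is a countable Borel equivalence relation on `X`: a Borel subset of `X × X` which is
an equivalence relation all of whose classes are countable. -/
def IsCtblBorelEqvRel {X : Type*} [MeasurableSpace X] (E : Set (X × X)) : Prop :=
  MeasurableSet E ∧ Equivalence (fun x y : X => (x, y) ∈ E) ∧
    ∀ x : X, {y | (x, y) ∈ E}.Countable

/-- A Borel equivalence relation is hyperfinite if it is the union of an increasing sequence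
of finite Borel subequivalence relations. -/
def Hyperfinite {X : Type*} [MeasurableSpace X] (R : Set (X × X)) : Prop :=
  ∃ Rn : ℕ → Set (X × X), Monotone Rn ∧
    (∀ n, MeasurableSet (Rn n) ∧ Equivalence (fun x y : X => (x, y) ∈ Rn n) ∧
      ∀ x : X, {y | (x, y) ∈ Rn n}.Finite) ∧
    (⋃ n, Rn n) = R

/-- A Borel equivalence relation `F` is smooth if its classes are separated by a Borel
function into a standard Borel space (equivalently, into `ℝ`). -/
def SmoothRel {X : Type*} [MeasurableSpace X] (F : Set (X × X)) : Prop :=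
  ∃ f : X → ℝ, Measurable f ∧ ∀ x y : X, ((x, y) ∈ F ↔ f x = f y)

section LusinNovikov

open Set

theorem MeasureTheory.AnalyticSet.inter_pair {α : Type*} [TopologicalSpace α] [T2Space α] {s t : Set α}
    (hs : AnalyticSet s) (ht : AnalyticSet t) : AnalyticSet (s ∩ t) := by
  rw [inter_eq_iInter]
  exact AnalyticSet.iInter fun b => by cases b <;> assumption

/-- A Borel set meeting every vertical section in at most one point. -/
def IsBorelGraph {X Y : Type*} [MeasurableSpace X] [MeasurableSpace Y] (G : Set (X × Y)) : Prop :=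
  MeasurableSet G ∧ ∀ x y y', (x, y) ∈ G → (x, y') ∈ G → y = y'

/-- A countable union of Borel graphs. -/
def IsSigmaGraph {X Y : Type*} [MeasurableSpace X] [MeasurableSpace Y] (B : Set (X × Y)) : Prop :=
  ∃ G : Set (Set (X × Y)), G.Countable ∧ (∀ g ∈ G, IsBorelGraph g) ∧ B = ⋃₀ G

section sigma
variable {X Y : Type*} [MeasurableSpace X] [MeasurableSpace Y]

theorem IsBorelGraph.isSigmaGraph {B : Set (X × Y)} (h : IsBorelGraph B) : IsSigmaGraph B :=
  ⟨{B}, countable_singleton _, by simpa using h, by simp⟩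

theorem IsSigmaGraph.empty : IsSigmaGraph (∅ : Set (X × Y)) :=
  ⟨∅, countable_empty, by simp, by simp⟩

theorem IsSigmaGraph.iUnion {ι : Type*} [Countable ι] {B : ι → Set (X × Y)}
    (h : ∀ i, IsSigmaGraph (B i)) : IsSigmaGraph (⋃ i, B i) := by
  choose G hG hG' hB using h
  refine ⟨⋃ i, G i, countable_iUnion hG, ?_, ?_⟩
  · intro g hg
    obtain ⟨i, hi⟩ := mem_iUnion.1 hg
    exact hG' i g hi
  · rw [sUnion_iUnion]
    exact iUnion_congr hB

theorem IsSigmaGraph.union {B C : Set (X × Y)} (hB : IsSigmaGraph B) (hC : IsSigmaGraph C) :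
    IsSigmaGraph (B ∪ C) := by
  rw [union_eq_iUnion]
  exact IsSigmaGraph.iUnion fun b => by cases b <;> assumption

theorem IsSigmaGraph.measurableSet {B : Set (X × Y)} (hB : IsSigmaGraph B) : MeasurableSet B := by
  obtain ⟨G, hG, hG', rfl⟩ := hB
  exact MeasurableSet.sUnion hG fun g hg => (hG' g hg).1

/-- A family of plane sets is negligible if over every point some member of the family has its
section covered by a prescribed countable union of Borel graphs. -/
def NegligibleFamily {ι : Type*} (A : ι → Set (X × Y)) : Prop :=
  ∃ B : ι → Set (X × Y), (∀ i, IsSigmaGraph (B i)) ∧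
    ∀ x, ∃ i, ∀ y, (x, y) ∈ A i → (x, y) ∈ B i

end sigma

variable {X Y : Type*} [TopologicalSpace X] [PolishSpace X] [MeasurableSpace X] [BorelSpace X]
  [TopologicalSpace Y] [PolishSpace Y] [MeasurableSpace Y] [BorelSpace Y]

/-- Finitely many analytic sets with empty intersection relative to an analytic set can be enlarged
to Borel sets with the same property. -/
theorem exists_borel_separation_finset {ι : Type*} [DecidableEq ι] (C : ι → Set X)
    (hC : ∀ i, AnalyticSet (C i)) (s : Finset ι) (D : Set X) (hD : AnalyticSet D)
    (h : ∀ x ∈ D, ∃ i ∈ s, x ∉ C i) :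
    ∃ W : ι → Set X, (∀ i, MeasurableSet (W i)) ∧ (∀ i, C i ⊆ W i) ∧
      ∀ x ∈ D, ∃ i ∈ s, x ∉ W i := by
  induction s using Finset.induction_on generalizing D with
  | empty =>
    refine ⟨fun _ => univ, fun _ => MeasurableSet.univ, fun _ => subset_univ _, ?_⟩
    intro x hx
    simpa using h x hx
  | insert a s ha ih =>
    obtain ⟨W, hW, hCW, hDW⟩ := ih (D ∩ C a) (hD.inter_pair (hC a)) (by
      rintro x ⟨hx, hxa⟩
      obtain ⟨i, hi, hxi⟩ := h x hx
      rcases Finset.mem_insert.1 hi with rfl | hi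
      · exact absurd hxa hxi
      · exact ⟨i, hi, hxi⟩)
    have hH : MeasurableSet (⋂ i ∈ s, W i) := Finset.measurableSet_biInter _ fun i _ => hW i
    obtain ⟨V, hV1, hV2, hV3⟩ := (hC a).measurablySeparable (hD.inter_pair hH.analyticSet) (by
      rw [Set.disjoint_left]
      rintro x hxa ⟨hxD, hxH⟩
      obtain ⟨i, hi, hxi⟩ := hDW x ⟨hxD, hxa⟩
      exact hxi (mem_iInter₂.1 hxH i hi))
    refine ⟨Function.update W a V, fun i => ?_, fun i => ?_, fun x hx => ?_⟩
    · by_cases hi : i = a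
      · subst hi; simpa
      · simpa [hi] using hW i
    · by_cases hi : i = a
      · subst hi; simpa
      · simpa [hi] using hCW i
    · by_cases hxV : x ∈ V
      · have : x ∉ ⋂ i ∈ s, W i := fun hxH => (Set.disjoint_left.1 hV2) ⟨hx, hxH⟩ hxV
        simp only [mem_iInter, not_forall] at this
        obtain ⟨i, hi, hxi⟩ := this
        refine ⟨i, Finset.mem_insert_of_mem hi, ?_⟩
        have : i ≠ a := by rintro rfl; exact ha hi
        simpa [this] using hxi
      · exact ⟨a, Finset.mem_insert_self _ _, by simpa using hxV⟩

/-- An analytic set with at most one point in every vertical section is contained in a Borel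
graph. -/
theorem exists_isBorelGraph_superset {A : Set (X × Y)} (hA : AnalyticSet A)
    (h : ∀ x y y', (x, y) ∈ A → (x, y') ∈ A → y = y') : ∃ G, IsBorelGraph G ∧ A ⊆ G := by
  obtain ⟨U, hU, hsep⟩ := exists_seq_separating Y MeasurableSet.empty univ
  have hproj : ∀ V : Set Y, MeasurableSet V → AnalyticSet (Prod.fst '' (A ∩ Prod.snd ⁻¹' V)) :=
    fun V hV => (hA.inter_pair (measurable_snd hV).analyticSet).image_of_continuous continuous_fst
  have : ∀ j, MeasurablySeparable (Prod.fst '' (A ∩ Prod.snd ⁻¹' U j))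
      (Prod.fst '' (A ∩ Prod.snd ⁻¹' (U j)ᶜ)) := by
    intro j
    refine (hproj _ (hU j)).measurablySeparable (hproj _ (hU j).compl) ?_
    rw [Set.disjoint_left]
    rintro _ ⟨⟨x, y⟩, ⟨hy, hyU⟩, rfl⟩ ⟨⟨x', y'⟩, ⟨hy', hyU'⟩, rfl : x' = x⟩
    obtain rfl := h _ _ _ hy hy'
    exact hyU' hyU
  choose W hW1 hW2 hW3 using this
  refine ⟨{p | ∀ j, p.2 ∈ U j ↔ p.1 ∈ W j}, ⟨?_, ?_⟩, ?_⟩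
  · rw [measurableSet_setOfPred]
    have h1 : ∀ j, Measurable fun p : X × Y => p.2 ∈ U j := fun j => (hU j).mem.comp measurable_snd
    have h2 : ∀ j, Measurable fun p : X × Y => p.1 ∈ W j := fun j => (hW3 j).mem.comp measurable_fst
    fun_prop
  · intro x y y' hy hy'
    exact hsep y (mem_univ _) y' (mem_univ _) fun j => (hy j).trans (hy' j).symm
  · rintro ⟨x, y⟩ hxy j
    refine ⟨fun hj => hW1 j ⟨(x, y), ⟨hxy, hj⟩, rfl⟩, fun hj => ?_⟩
    by_contra hn
    exact (Set.disjoint_left.1 (hW2 j)) ⟨(x, y), ⟨hxy, hn⟩, rfl⟩ hj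

/-- The set of points over which an analytic set has at least two points is analytic. -/
theorem analyticSet_two_le_section {A : Set (X × Y)} (hA : AnalyticSet A) :
    AnalyticSet {x | ∃ y y', (x, y) ∈ A ∧ (x, y') ∈ A ∧ y ≠ y'} := by
  obtain ⟨U, hU, hsep⟩ := exists_seq_separating Y MeasurableSet.empty univ
  have hproj : ∀ V : Set Y, MeasurableSet V → AnalyticSet (Prod.fst '' (A ∩ Prod.snd ⁻¹' V)) :=
    fun V hV => (hA.inter_pair (measurable_snd hV).analyticSet).image_of_continuous continuous_fst
  convert AnalyticSet.iUnion fun j => (hproj _ (hU j)).inter_pair (hproj _ (hU j).compl) using 1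
  ext x
  simp only [mem_ofPred_eq, mem_iUnion]
  constructor
  · rintro ⟨y, y', hy, hy', hne⟩
    have : ¬ ∀ j, y ∈ U j ↔ y' ∈ U j := fun hj => hne (hsep y (mem_univ _) y' (mem_univ _) hj)
    push Not at this
    obtain ⟨j, ⟨h1, h2⟩ | ⟨h1, h2⟩⟩ := this
    · exact ⟨j, ⟨(x, y), ⟨hy, h1⟩, rfl⟩, ⟨(x, y'), ⟨hy', h2⟩, rfl⟩⟩
    · exact ⟨j, ⟨(x, y'), ⟨hy', h2⟩, rfl⟩, ⟨(x, y), ⟨hy, h1⟩, rfl⟩⟩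
  · rintro ⟨j, ⟨⟨_, y⟩, ⟨hy, h1⟩, rfl⟩, ⟨⟨_, y'⟩, ⟨hy', h2⟩, rfl⟩⟩
    exact ⟨y, y', hy, hy', by rintro rfl; exact h2 h1⟩

/-- A non-negligible family of analytic sets given by closed sets of parameters can be split in
two, with small pieces that are disjoint in the second coordinate. -/
theorem exists_split_of_not_negligibleFamily {Z : Type*} [MetricSpace Z] [CompleteSpace Z]
    [SecondCountableTopology Z] [Nonempty Z] (ψ : Z → X × Y) (hψ : Continuous ψ) {ι : Type*}
    [Finite ι]
    (C : ι → Set Z) (hC : ∀ i, IsClosed (C i)) (hN : ¬ NegligibleFamily fun i => ψ '' C i)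
    (ε : ℝ) (hε : 0 < ε) :
    ∃ C' : ι → Bool → Set Z, (∀ i b, IsClosed (C' i b)) ∧ (∀ i b, C' i b ⊆ C i) ∧
      (∀ i b, ∀ z ∈ C' i b, ∀ w ∈ C' i b, dist z w ≤ ε) ∧
      (∀ i, ∀ z ∈ C' i true, ∀ w ∈ C' i false, (ψ z).2 ≠ (ψ w).2) ∧
      ¬ NegligibleFamily fun j : ι × Bool => ψ '' C' j.1 j.2 := by
  classical
  cases nonempty_fintype ι
  by_contra hcon
  push Not at hcon
  let Q : ι → ((ℕ × ℕ) × (ℕ × ℕ)) → Bool → Set Z := fun i j b =>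
    C i ∩ Metric.closedBall (TopologicalSpace.denseSeq Z (bif b then j.1.1 else j.2.1))
      (ε / 2 / ((bif b then j.1.2 else j.2.2) + 1))
  have hQc : ∀ i j b, IsClosed (Q i j b) := fun i j b => (hC i).inter Metric.isClosed_closedBall
  have hQ : ∀ J : ι → ((ℕ × ℕ) × (ℕ × ℕ)), ∃ B : ι × Bool → Set (X × Y),
      (∀ k, IsSigmaGraph (B k)) ∧
      ((∀ i, ∀ z ∈ Q i (J i) true, ∀ w ∈ Q i (J i) false, (ψ z).2 ≠ (ψ w).2) →
        ∀ x, ∃ k : ι × Bool, ∀ y, (x, y) ∈ ψ '' Q k.1 (J k.1) k.2 → (x, y) ∈ B k) := by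
    intro J
    by_cases hJ : ∀ i, ∀ z ∈ Q i (J i) true, ∀ w ∈ Q i (J i) false, (ψ z).2 ≠ (ψ w).2
    · obtain ⟨B, hB, hB'⟩ := hcon (fun i b => Q i (J i) b) (fun i b => hQc i _ b)
        (fun i b => inter_subset_left) (by
          rintro i b z ⟨-, hz⟩ w ⟨-, hw⟩
          rw [Metric.mem_closedBall] at hz hw
          have h1 : ε / 2 / (((bif b then (J i).1.2 else (J i).2.2 : ℕ) : ℝ) + 1) ≤ ε / 2 :=
            div_le_self (by positivity) (by simp)
          have := dist_triangle_right z w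
            (TopologicalSpace.denseSeq Z (bif b then (J i).1.1 else (J i).2.1))
          linarith) hJ
      exact ⟨B, hB, fun _ => hB'⟩
    · exact ⟨fun _ => ∅, fun _ => IsSigmaGraph.empty, fun h => absurd h hJ⟩
  choose B hB hBJ using hQ
  let B' : ι → Set (X × Y) := fun i => ⋃ (J : ι → ((ℕ × ℕ) × (ℕ × ℕ))), ⋃ b : Bool, B J (i, b)
  have hB' : ∀ i, IsSigmaGraph (B' i) :=
    fun i => IsSigmaGraph.iUnion fun J => IsSigmaGraph.iUnion fun b => hB J _
  let A' : ι → Set (X × Y) := fun i => ψ '' C i ∩ (B' i)ᶜ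
  have hA' : ∀ i, AnalyticSet (A' i) := fun i =>
    ((hC i).analyticSet.image_of_continuous hψ).inter_pair (hB' i).measurableSet.compl.analyticSet
  obtain ⟨W, hW, hCW, hWe⟩ := exists_borel_separation_finset
    (fun i => {x | ∃ y y', (x, y) ∈ A' i ∧ (x, y') ∈ A' i ∧ y ≠ y'})
    (fun i => analyticSet_two_le_section (hA' i)) Finset.univ univ
    MeasurableSet.univ.analyticSet (by
      intro x _
      by_contra hx
      push Not at hx
      have hx' : ∀ i, ∃ j : (ℕ × ℕ) × (ℕ × ℕ),
          (∀ z ∈ Q i j true, ∀ w ∈ Q i j false, (ψ z).2 ≠ (ψ w).2) ∧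
          ∀ b, ∃ y, (x, y) ∈ ψ '' Q i j b ∧ (x, y) ∉ B' i := by
        intro i
        obtain ⟨y, y', ⟨⟨p, hp, hpy⟩, hyB⟩, ⟨⟨q, hq, hqy⟩, hyB'⟩, hne⟩ := hx i (Finset.mem_univ _)
        obtain ⟨u, v, hu, hv, hyu, hyv, huv⟩ := t2_separation hne
        have hcont : Continuous fun z => (ψ z).2 := continuous_snd.comp hψ
        have key : ∀ (p : Z) (u : Set Y), IsOpen u → (ψ p).2 ∈ u → ∃ k m : ℕ,
            p ∈ Metric.closedBall (TopologicalSpace.denseSeq Z k) (ε / 2 / (m + 1)) ∧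
            ∀ z ∈ Metric.closedBall (TopologicalSpace.denseSeq Z k) (ε / 2 / (m + 1)),
              (ψ z).2 ∈ u := by
          intro p u hu hpu
          obtain ⟨δ, hδ, hball⟩ := Metric.isOpen_iff.1 (hu.preimage hcont) p hpu
          obtain ⟨m, hm⟩ := exists_nat_gt (ε / δ)
          have hm1 : (0 : ℝ) < (m : ℝ) + 1 := by positivity
          have hr : 0 < ε / 2 / ((m : ℝ) + 1) := by positivity
          have hr2 : ε / 2 / ((m : ℝ) + 1) < δ / 2 := by
            rw [div_lt_iff₀ hδ] at hm
            rw [div_lt_iff₀ hm1]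
            nlinarith
          obtain ⟨k, hk⟩ := (TopologicalSpace.denseRange_denseSeq Z).exists_dist_lt p hr
          refine ⟨k, m, hk.le, fun z hz => hball ?_⟩
          rw [Metric.mem_closedBall] at hz
          rw [Metric.mem_ball]
          have := dist_triangle_right z p (TopologicalSpace.denseSeq Z k)
          linarith
        obtain ⟨k, m, hpk, hk⟩ := key p u hu (by rw [hpy]; exact hyu)
        obtain ⟨k', m', hqk, hk'⟩ := key q v hv (by rw [hqy]; exact hyv)
        refine ⟨((k, m), (k', m')), ?_, ?_⟩
        · rintro z ⟨-, hz⟩ w ⟨-, hw⟩ he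
          exact (Set.disjoint_left.1 huv) (hk z hz) (he ▸ hk' w hw)
        · rintro (_ | _)
          · exact ⟨y', ⟨q, ⟨hq, hqk⟩, hqy⟩, hyB'⟩
          · exact ⟨y, ⟨p, ⟨hp, hpk⟩, hpy⟩, hyB⟩
      choose J hJ1 hJ2 using hx'
      obtain ⟨⟨i, b⟩, hib⟩ := hBJ J hJ1 x
      obtain ⟨y, hy, hyB⟩ := hJ2 i b
      exact hyB (mem_iUnion₂.2 ⟨J, b, hib y hy⟩))
  have hG : ∀ i, ∃ G, IsBorelGraph G ∧ A' i ∩ (Prod.fst ⁻¹' W i)ᶜ ⊆ G := by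
    intro i
    refine exists_isBorelGraph_superset
      ((hA' i).inter_pair (measurable_fst (hW i)).compl.analyticSet) ?_
    rintro x y y' ⟨hy, hxW⟩ ⟨hy', -⟩
    by_contra hne
    exact hxW (hCW i ⟨y, y', hy, hy', hne⟩)
  choose G hG hAG using hG
  refine hN ⟨fun i => B' i ∪ G i, fun i => (hB' i).union (hG i).isSigmaGraph, fun x => ?_⟩
  obtain ⟨i, -, hi⟩ := hWe x (mem_univ _)
  refine ⟨i, fun y hy => ?_⟩
  by_cases hyB : (x, y) ∈ B' i
  · exact Or.inl hyB
  · exact Or.inr (hAG i ⟨⟨hy, hyB⟩, hi⟩)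

/-- The parametrized form of the Lusin–Novikov theorem. -/
theorem exists_isSigmaGraph_superset_range {Z : Type*} [MetricSpace Z] [CompleteSpace Z]
    [SecondCountableTopology Z] [Nonempty Z] (ψ : Z → X × Y) (hψ : Continuous ψ)
    (hcount : ∀ x, {y | (x, y) ∈ range ψ}.Countable) : ∃ B, IsSigmaGraph B ∧ range ψ ⊆ B := by
  by_contra hcon
  let P : (n : ℕ) → ((Fin n → Bool) → Set Z) → Prop := fun n C =>
    (∀ v, IsClosed (C v)) ∧ ¬ NegligibleFamily fun v => ψ '' C v
  have hstep : ∀ n (C : {C // P n C}), ∃ C' : {C // P (n + 1) C},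
      (∀ v, C'.1 v ⊆ C.1 (Fin.init v)) ∧
      (∀ v, ∀ z ∈ C'.1 v, ∀ w ∈ C'.1 v, dist z w ≤ (1 / 2) ^ n) ∧
      ∀ v v' : Fin (n + 1) → Bool, Fin.init v = Fin.init v' →
        v (Fin.last n) ≠ v' (Fin.last n) → ∀ z ∈ C'.1 v, ∀ w ∈ C'.1 v', (ψ z).2 ≠ (ψ w).2 := by
    rintro n ⟨C, hC, hN⟩
    obtain ⟨C', h1, h2, h3, h4, h5⟩ := exists_split_of_not_negligibleFamily ψ hψ C hC hN
      ((1 / 2) ^ n) (by positivity)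
    refine ⟨⟨fun v => C' (Fin.init v) (v (Fin.last n)), fun v => h1 _ _, ?_⟩, fun v => h2 _ _,
      fun v => h3 _ _, ?_⟩
    · rintro ⟨B, hB, hB'⟩
      refine h5 ⟨fun j => B (Fin.snoc j.1 j.2), fun j => hB _, fun x => ?_⟩
      obtain ⟨v, hv⟩ := hB' x
      refine ⟨(Fin.init v, v (Fin.last n)), ?_⟩
      simpa using hv
    · intro v v' hv hne z hz w hw
      cases h : v (Fin.last n) <;> cases h' : v' (Fin.last n)
      · simp [h, h'] at hne
      · simp only [h, h', hv] at hz hw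
        exact fun he => h4 _ _ hw _ hz he.symm
      · simp only [h, h', hv] at hz hw
        exact h4 _ _ hz _ hw
      · simp [h, h'] at hne
  choose next hn1 hn2 hn3 using hstep
  let C : (n : ℕ) → {C // P n C} := fun n => Nat.rec (motive := fun n => {C // P n C})
    ⟨fun _ => univ, fun _ => isClosed_univ, fun ⟨B, hB, hB'⟩ => hcon ⟨B default, hB _, by
      rintro ⟨x, y⟩ hxy
      obtain ⟨i, hi⟩ := hB' x
      obtain rfl : i = default := Subsingleton.elim _ _
      exact hi y (by simpa using hxy)⟩⟩ (fun n C => next n C) n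
  have hCs : ∀ n, C (n + 1) = next n (C n) := fun n => rfl
  have hx : ∀ n, ∃ x, ∀ v, ∃ z ∈ (C n).1 v, (ψ z).1 = x := by
    intro n
    by_contra hx
    push Not at hx
    refine (C n).2.2 ⟨fun _ => ∅, fun _ => IsSigmaGraph.empty, fun x => ?_⟩
    obtain ⟨v, hv⟩ := hx x
    refine ⟨v, ?_⟩
    rintro y ⟨z, hz, hzy⟩
    exact (hv z hz (by rw [hzy])).elim
  choose x z hzC hzx using hx
  let br : (ℕ → Bool) → (n : ℕ) → Fin n → Bool := fun b n i => b i
  have hmono : ∀ b n m, n ≤ m → (C m).1 (br b m) ⊆ (C n).1 (br b n) := by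
    intro b n m hnm
    induction hnm with
    | refl => exact Subset.rfl
    | step h ih => exact (hn1 _ _ _).trans ih
  have hlim : ∀ b, ∃ p : Z,
      Filter.Tendsto (fun n => z (n + 1) (br b (n + 1))) Filter.atTop (nhds p) := by
    intro b
    refine cauchySeq_tendsto_of_complete (u := fun n => z (n + 1) (br b (n + 1))) ?_
    refine cauchySeq_of_le_tendsto_0 (s := fun n => z (n + 1) (br b (n + 1)))
      (fun n => (1 / 2 : ℝ) ^ n) ?_ ?_
    · intro n m N hn hm
      exact hn2 N (C N) (br b (N + 1)) _ (hmono b (N + 1) (n + 1) (by omega) (hzC (n + 1) _)) _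
        (hmono b (N + 1) (m + 1) (by omega) (hzC (m + 1) _))
    · exact tendsto_pow_atTop_nhds_zero_of_lt_one (by norm_num) (by norm_num)
  choose p hp using hlim
  have hpC : ∀ b n, p b ∈ (C n).1 (br b n) := fun b n =>
    ((C n).2.1 _).mem_of_tendsto (hp b) (Filter.eventually_atTop.2
      ⟨n, fun m hm => hmono b n (m + 1) (by omega) (hzC (m + 1) _)⟩)
  have hpx : ∀ b, Filter.Tendsto (fun n => x (n + 1)) Filter.atTop (nhds (ψ (p b)).1) := by
    intro b
    have := ((continuous_fst.comp hψ).tendsto (p b)).comp (hp b)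
    simpa [Function.comp_def, hzx] using this
  have hinj : Function.Injective fun b => (ψ (p b)).2 := by
    intro b b' hbb
    by_contra hne
    have hex : ∃ n, b n ≠ b' n := Function.ne_iff.1 hne
    classical
    have hlt : ∀ m < Nat.find hex, b m = b' m := fun m hm => not_not.1 (Nat.find_min hex hm)
    exact hn3 _ (C (Nat.find hex)) (br b _) (br b' _) (funext fun i => hlt i i.2)
      (Nat.find_spec hex) _ (hpC b (Nat.find hex + 1)) _ (hpC b' (Nat.find hex + 1)) hbb
  have hmem : ∀ b, (ψ (p b)).2 ∈ {y | ((ψ (p default)).1, y) ∈ range ψ} := by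
    intro b
    rw [tendsto_nhds_unique (hpx default) (hpx b)]
    exact ⟨p b, rfl⟩
  have hc : Countable (ℕ → Bool) := by
    have := (hcount (ψ (p default)).1).to_subtype
    exact Function.Injective.countable (f := fun b => (⟨_, hmem b⟩ :
      {y | ((ψ (p default)).1, y) ∈ range ψ})) fun b b' h => hinj (Subtype.ext_iff.1 h)
  classical
  obtain ⟨f, hf⟩ := hc.exists_injective_nat
  exact Function.cantor_injective (fun s : Set ℕ => f fun n => decide (n ∈ s)) fun s t hst => by
    ext n
    simpa using congrFun (hf hst) n

/-- **Lusin–Novikov**: an analytic plane set with countable vertical sections is covered by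
countably many Borel graphs. -/
theorem exists_isSigmaGraph_superset {A : Set (X × Y)} (hA : AnalyticSet A)
    (hcount : ∀ x, {y | (x, y) ∈ A}.Countable) : ∃ B, IsSigmaGraph B ∧ A ⊆ B := by
  rw [AnalyticSet] at hA
  rcases hA with rfl | ⟨ψ, hψ, rfl⟩
  · exact ⟨∅, IsSigmaGraph.empty, Subset.rfl⟩
  let := TopologicalSpace.upgradeIsCompletelyMetrizable (ℕ → ℕ)
  exact exists_isSigmaGraph_superset_range ψ hψ hcount

/-- **Feldman–Moore**: a countable Borel equivalence relation is the union of the graphs of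
countably many Borel involutions. -/
theorem exists_involutions_of_isCtblBorelEqvRel {X : Type*} [MeasurableSpace X]
    [StandardBorelSpace X] (E : Set (X × X)) (hE : MeasurableSet E)
    (heq : Equivalence fun x y : X => (x, y) ∈ E) (hcount : ∀ x : X, {y | (x, y) ∈ E}.Countable) :
    ∃ φ : ℕ → X → X, (∀ n, Measurable (φ n)) ∧ (∀ n x, φ n (φ n x) = x) ∧
      ∀ x y, (x, y) ∈ E ↔ ∃ n, φ n x = y := by
  classical
  let := upgradeStandardBorel X
  obtain ⟨B, ⟨G, hG, hG', rfl⟩, hEB⟩ := exists_isSigmaGraph_superset hE.analyticSet hcount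
  obtain ⟨H, hH⟩ : ∃ H : ℕ → Set (X × X), insert ∅ G = range H :=
    (hG.insert ∅).exists_eq_range (insert_nonempty _ _)
  have hHG : ∀ n, IsBorelGraph (H n ∩ E) := by
    intro n
    have hn : H n ∈ insert ∅ G := hH ▸ mem_range_self n
    rcases hn with h | h
    · rw [h]; exact ⟨by simp, by simp⟩
    · exact ⟨(hG' _ h).1.inter hE, fun x y y' hy hy' => (hG' _ h).2 x y y' hy.1 hy'.1⟩
  have hEH : ∀ x y, (x, y) ∈ E → ∃ n, (x, y) ∈ H n := by
    intro x y hxy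
    obtain ⟨g, hg, hxg⟩ := hEB hxy
    obtain ⟨n, rfl⟩ : g ∈ range H := hH ▸ mem_insert_of_mem _ hg
    exact ⟨n, hxg⟩
  obtain ⟨U, hU, hsep⟩ := exists_seq_separating X MeasurableSet.empty univ
  let K : ℕ × ℕ × ℕ → Set (X × X) := fun j =>
    {q | q ∈ H j.1 ∩ E ∧ q.swap ∈ H j.2.1 ∩ E ∧ q.1 ∈ U j.2.2 ∧ q.2 ∉ U j.2.2}
  have hK : ∀ j, MeasurableSet (K j) := by
    intro j
    have h1 := (hHG j.1).1
    have h2 := measurable_swap (hHG j.2.1).1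
    have h3 : MeasurableSet (Prod.fst ⁻¹' U j.2.2 : Set (X × X)) := measurable_fst (hU _)
    have h4 : MeasurableSet (Prod.snd ⁻¹' (U j.2.2)ᶜ : Set (X × X)) := measurable_snd (hU _).compl
    exact h1.inter (h2.inter (h3.inter h4))
  let L : ℕ × ℕ × ℕ → Set (X × X) := fun j => K j ∪ Prod.swap ⁻¹' K j
  have hL : ∀ j, MeasurableSet (L j) := fun j => (hK j).union (measurable_swap (hK j))
  have hLsymm : ∀ j x y, (x, y) ∈ L j → (y, x) ∈ L j := by
    rintro j x y (h | h)
    · exact Or.inr h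
    · exact Or.inl h
  have hLfun : ∀ j x y y', (x, y) ∈ L j → (x, y') ∈ L j → y = y' := by
    rintro j x y y' (⟨h1, -, h3, h4⟩ | ⟨-, h2, h3, h4⟩) (⟨h1', -, h3', h4'⟩ | ⟨-, h2', h3', h4'⟩)
    · exact (hHG _).2 _ _ _ h1 h1'
    · exact absurd h3 h4'
    · exact absurd h3' h4
    · exact (hHG _).2 _ _ _ h2 h2'
  have hLE : ∀ j x y, (x, y) ∈ L j → (x, y) ∈ E := by
    rintro j x y (⟨h1, -⟩ | ⟨-, h2, -⟩)
    · exact h1.2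
    · exact h2.2
  let φ : ℕ × ℕ × ℕ → X → X := fun j x => if h : ∃ y, (x, y) ∈ L j then h.choose else x
  have hφ : ∀ j x y, (x, y) ∈ L j → φ j x = y := by
    intro j x y hxy
    have h : ∃ y, (x, y) ∈ L j := ⟨y, hxy⟩
    simp only [φ, dif_pos h]
    exact hLfun j x _ _ h.choose_spec hxy
  have hφ' : ∀ j x, (¬ ∃ y, (x, y) ∈ L j) → φ j x = x := fun j x h => by simp only [φ, dif_neg h]
  have himg : ∀ j S, MeasurableSet S → MeasurableSet (Prod.fst '' (L j ∩ Prod.snd ⁻¹' S)) := by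
    intro j S hS
    refine ((hL j).inter (measurable_snd hS)).image_of_measurable_injOn measurable_fst ?_
    rintro ⟨x, y⟩ ⟨h, -⟩ ⟨x', y'⟩ ⟨h', -⟩ (rfl : x = x')
    rw [hLfun j x y y' h h']
  have hφm : ∀ j, Measurable (φ j) := by
    intro j S hS
    have : φ j ⁻¹' S = Prod.fst '' (L j ∩ Prod.snd ⁻¹' S) ∪
        (S \ Prod.fst '' (L j ∩ Prod.snd ⁻¹' univ)) := by
      ext x
      by_cases h : ∃ y, (x, y) ∈ L j
      · obtain ⟨y, hy⟩ := h
        have h2 : ∀ y', (x, y') ∈ L j ↔ y' = y :=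
          fun y' => ⟨fun h => hLfun j x _ _ h hy, by rintro rfl; exact hy⟩
        simp [hφ j x y hy, h2]
      · have h1 := hφ' j x h
        push Not at h
        simp [h1, h]
    rw [this]
    exact (himg j S hS).union (hS.diff (himg j _ MeasurableSet.univ))
  have hφE : ∀ j x, (x, φ j x) ∈ E := by
    intro j x
    by_cases h : ∃ y, (x, y) ∈ L j
    · obtain ⟨y, hy⟩ := h
      rw [hφ j x y hy]; exact hLE j x y hy
    · rw [hφ' j x h]; exact heq.refl x
  have hφφ : ∀ j x, φ j (φ j x) = x := by
    intro j x
    by_cases h : ∃ y, (x, y) ∈ L j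
    · obtain ⟨y, hy⟩ := h
      rw [hφ j x y hy]; exact hφ j y x (hLsymm j x y hy)
    · rw [hφ' j x h, hφ' j x h]
  have hsurj : ∀ x y, (x, y) ∈ E → x ≠ y → ∃ j, φ j x = y := by
    intro x y hxy hne
    obtain ⟨n, hn⟩ := hEH x y hxy
    obtain ⟨m, hm⟩ := hEH y x (heq.symm hxy)
    have : ¬ ∀ j, x ∈ U j ↔ y ∈ U j := fun hj => hne (hsep x (mem_univ _) y (mem_univ _) hj)
    push Not at this
    obtain ⟨j, ⟨h1, h2⟩ | ⟨h1, h2⟩⟩ := this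
    · exact ⟨(n, m, j), hφ _ _ _ (Or.inl ⟨⟨hn, hxy⟩, ⟨hm, heq.symm hxy⟩, h1, h2⟩)⟩
    · exact ⟨(m, n, j), hφ _ _ _ (Or.inr ⟨⟨hm, heq.symm hxy⟩, ⟨hn, hxy⟩, h2, h1⟩)⟩
  obtain ⟨e, he⟩ := exists_surjective_nat (Option (ℕ × ℕ × ℕ))
  let Φ : Option (ℕ × ℕ × ℕ) → X → X := fun o => o.elim id φ
  have hΦm : ∀ o, Measurable (Φ o) := by
    rintro (_ | j)
    exacts [measurable_id, hφm j]
  have hΦΦ : ∀ o x, Φ o (Φ o x) = x := by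
    rintro (_ | j) x
    exacts [rfl, hφφ j x]
  have hΦE : ∀ o x, (x, Φ o x) ∈ E := by
    rintro (_ | j) x
    exacts [heq.refl x, hφE j x]
  refine ⟨fun n => Φ (e n), fun n => hΦm _, fun n => hΦΦ _, fun x y => ⟨fun hxy => ?_, ?_⟩⟩
  · by_cases hne : x = y
    · obtain ⟨n, hn⟩ := he none
      exact ⟨n, by simpa [Φ, hn] using hne⟩
    · obtain ⟨j, hj⟩ := hsurj x y hxy hne
      obtain ⟨n, hn⟩ := he (some j)
      exact ⟨n, by simpa [Φ, hn] using hj⟩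
  · rintro ⟨n, rfl⟩
    exact hΦE _ _

end LusinNovikov

section Generated

/-- The equivalence relation `E` is generated by the Borel involutions `φ n`, in the strong sense
that it is the union of their graphs. -/
structure GeneratedBy {X : Type*} [MeasurableSpace X] (E : X → X → Prop) (φ : ℕ → X → X) :
    Prop where
  measurable : ∀ n, Measurable (φ n)
  involutive : ∀ n x, φ n (φ n x) = x
  equiv : Equivalence E
  iff : ∀ x y, E x y ↔ ∃ n, φ n x = y

theorem measurable_sInf_nat {α : Type*} [MeasurableSpace α] {P : α → ℕ → Prop}
    (hP : ∀ a, Measurable fun x => P x a) (hex : ∀ x, ∃ a, P x a) :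
    Measurable fun x => sInf {a | P x a} := by
  classical
  convert measurable_find hex fun k => measurableSet_setOfPred.2 (hP k) using 2 with x
  exact Nat.sInf_def (hex x)

namespace GeneratedBy

variable {X : Type*} [MeasurableSpace X] {E : X → X → Prop} {φ : ℕ → X → X}

theorem measurable_exists (h : GeneratedBy E φ) {α : Type*} [MeasurableSpace α] {u : α → X}
    (hu : Measurable u) {P : α → X → Prop} (hP : Measurable fun q : α × X => P q.1 q.2) :
    Measurable fun a => ∃ y, E (u a) y ∧ P a y := by
  have : (fun a => ∃ y, E (u a) y ∧ P a y) = fun a => ∃ n, P a (φ n (u a)) := by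
    ext a
    simp [h.iff]
  rw [this]
  exact Measurable.exists fun n => hP.comp (measurable_id.prodMk ((h.measurable n).comp hu))

theorem measurable_forall (h : GeneratedBy E φ) {α : Type*} [MeasurableSpace α] {u : α → X}
    (hu : Measurable u) {P : α → X → Prop} (hP : Measurable fun q : α × X => P q.1 q.2) :
    Measurable fun a => ∀ y, E (u a) y → P a y := by
  have : (fun a => ∀ y, E (u a) y → P a y) = fun a => ¬ ∃ y, E (u a) y ∧ ¬ P a y := by
    ext a
    simp
  rw [this]
  exact (h.measurable_exists hu hP.not).not

theorem measurable_finite [MeasurableEq X] (h : GeneratedBy E φ) {P : X → X → Prop}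
    (hP : Measurable fun q : X × X => P q.1 q.2) :
    Measurable fun x => {y | E x y ∧ P x y}.Finite := by
  have : (fun x => {y | E x y ∧ P x y}.Finite) = fun x =>
      ∃ m, ∀ n, P x (φ n x) → ∃ k : Fin m, φ k x = φ n x := by
    ext x
    constructor
    · intro hf
      have : ∀ y, ∃ n, E x y → φ n x = y := fun y => by
        by_cases hy : E x y
        · obtain ⟨n, hn⟩ := (h.iff x y).1 hy
          exact ⟨n, fun _ => hn⟩
        · exact ⟨0, fun h => absurd h hy⟩
      choose g hg using this
      obtain ⟨m, hm⟩ := (hf.image g).bddAbove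
      refine ⟨m + 1, fun n hn => ?_⟩
      have hE : E x (φ n x) := (h.iff _ _).2 ⟨n, rfl⟩
      exact ⟨⟨g (φ n x), Nat.lt_succ_of_le (hm ⟨_, ⟨hE, hn⟩, rfl⟩)⟩, hg _ hE⟩
    · rintro ⟨m, hm⟩
      refine (Set.finite_range fun k : Fin m => φ k x).subset ?_
      rintro y ⟨hy, hPy⟩
      obtain ⟨n, rfl⟩ := (h.iff _ _).1 hy
      exact hm n hPy
  rw [this]
  have h1 := h.measurable
  have h2 : ∀ n, Measurable fun x => P x (φ n x) := fun n =>
    hP.comp (measurable_id.prodMk (h1 n))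
  have h3 : ∀ k n, Measurable fun x => φ k x = φ n x := fun k n =>
    measurableSet_setOfPred.1 (measurableSet_eq_fun (h1 k) (h1 n))
  fun_prop

variable [StandardBorelSpace X]

theorem measurable_rel (h : GeneratedBy E φ) : Measurable fun q : X × X => E q.1 q.2 := by
  simp only [h.iff]
  exact Measurable.exists fun n => measurableSet_setOfPred.1
    (measurableSet_eq_fun ((h.measurable n).comp measurable_fst) measurable_snd)

/-- A Borel graph of degree at most `N` inside `E` has a Borel proper colouring by
`0, …, N`. -/
theorem exists_bounded_coloring (h : GeneratedBy E φ) {G : X → X → Prop}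
    (hG : Measurable fun q : X × X => G q.1 q.2) (hGE : ∀ x y, G x y → E x y)
    (hsymm : ∀ x y, G x y → G y x) (hirr : ∀ x, ¬ G x x) {N : ℕ}
    (hfin : ∀ x, {y | G x y}.Finite) (hN : ∀ x, {y | G x y}.ncard ≤ N) :
    ∃ c : X → ℕ, Measurable c ∧ (∀ x, c x ≤ N) ∧ ∀ x y, G x y → c x ≠ c y := by
  classical
  obtain ⟨V, hV, hVsep⟩ : ∃ V : ℕ → Set X, (∀ j, MeasurableSet (V j)) ∧
      ∀ x (F : Set X), F.Finite → x ∉ F → ∃ j, x ∈ V j ∧ ∀ y ∈ F, y ∉ V j := by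
    let := upgradeStandardBorel X
    obtain ⟨V, hV⟩ := ((TopologicalSpace.countable_countableBasis X).insert ∅).exists_eq_range
      (Set.insert_nonempty _ _)
    refine ⟨V, fun j => ?_, fun x F hF hx => ?_⟩
    · have : V j ∈ insert ∅ (TopologicalSpace.countableBasis X) := hV ▸ Set.mem_range_self j
      rcases this with h | h
      · rw [h]; exact MeasurableSet.empty
      · exact ((TopologicalSpace.isBasis_countableBasis X).isOpen h).measurableSet
    · obtain ⟨v, hv, hxv, hvF⟩ :=
        (TopologicalSpace.isBasis_countableBasis X).exists_subset_of_mem_open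
          (show x ∈ Fᶜ from hx) hF.isClosed.isOpen_compl
      obtain ⟨j, rfl⟩ : v ∈ Set.range V := hV ▸ Set.mem_insert_of_mem _ hv
      exact ⟨j, hxv, fun y hy hyv => hvF hyv hy⟩
  have hforall : ∀ Q : X → Prop, Measurable Q → Measurable fun x => ∀ y, G x y → Q y := by
    intro Q hQ
    have : (fun x => ∀ y, G x y → Q y) = fun x => ∀ y, E x y → G x y → Q y := by
      ext x
      exact ⟨fun H y _ => H y, fun H y hy => H y (hGE _ _ hy) hy⟩
    rw [this]
    exact h.measurable_forall measurable_id (P := fun x y => G x y → Q y)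
      (hG.imp (hQ.comp measurable_snd))
  have hex : ∀ x, ∃ j, x ∈ V j ∧ ∀ y, G x y → y ∉ V j := fun x => hVsep x _ (hfin x) (hirr x)
  let c₀ : X → ℕ := fun x => sInf {j | x ∈ V j ∧ ∀ y, G x y → y ∉ V j}
  have hc₀ : Measurable c₀ := measurable_sInf_nat
    (fun j => (hV j).mem.and (hforall _ (hV j).mem.not)) hex
  have hc₀' : ∀ x, x ∈ V (c₀ x) ∧ ∀ y, G x y → y ∉ V (c₀ x) := fun x => Nat.sInf_mem (hex x)
  have hne : ∀ x y, G x y → c₀ x ≠ c₀ y := by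
    intro x y hxy he
    exact (hc₀' x).2 y hxy (he ▸ (hc₀' y).1)
  have hfree : ∀ (g : X → ℕ) x, ∃ a ≤ N, ∀ y, G x y → g y ≠ a := by
    intro g x
    by_contra hcon
    push Not at hcon
    have hsub : ((Finset.range (N + 1) : Finset ℕ) : Set ℕ) ⊆ g '' {y | G x y} := by
      intro a ha
      obtain ⟨y, hy, hya⟩ := hcon a (by simpa [Nat.lt_succ_iff] using ha)
      exact ⟨y, hy, hya⟩
    have h1 := Set.ncard_le_ncard hsub ((hfin x).image g)
    have h2 := Set.ncard_image_le (f := g) (hfin x)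
    rw [Set.ncard_coe_finset, Finset.card_range] at h1
    have := hN x
    omega
  let col : ℕ → X → ℕ := fun m => Nat.rec (fun _ => 0) (fun m g x =>
    if c₀ x = m then sInf {a | ∀ y, G x y → c₀ y < m → g y ≠ a} else g x) m
  have hcolS : ∀ m x, col (m + 1) x =
      if c₀ x = m then sInf {a | ∀ y, G x y → c₀ y < m → col m y ≠ a} else col m x :=
    fun m x => rfl
  have hfree' : ∀ m x, ∃ a ≤ N, ∀ y, G x y → c₀ y < m → col m y ≠ a := fun m x => by
    obtain ⟨a, ha, H⟩ := hfree (col m) x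
    exact ⟨a, ha, fun y hy _ => H y hy⟩
  have hcolm : ∀ m, Measurable (col m) := by
    intro m
    induction m with
    | zero => exact measurable_const
    | succ m ih =>
      refine Measurable.ite (measurableSet_setOfPred.2 (hc₀.eq_const m)) ?_ ih
      refine measurable_sInf_nat (fun a => hforall (fun y => c₀ y < m → col m y ≠ a) ?_)
        fun x => (hfree' m x).imp fun a => And.right
      exact (measurableSet_setOfPred.1 (measurableSet_lt hc₀ measurable_const)).imp
        (ih.eq_const a).not
  have hstab : ∀ x m, c₀ x < m → col m x = col (c₀ x + 1) x := by
    intro x m hm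
    induction m with
    | zero => omega
    | succ m ih =>
      rcases Nat.lt_succ_iff_lt_or_eq.1 hm with hlt | rfl
      · rw [hcolS, if_neg (by omega), ih hlt]
      · rfl
  have hspec : ∀ x y, G x y → c₀ y < c₀ x → col (c₀ y + 1) y ≠ col (c₀ x + 1) x := by
    intro x y hxy hlt
    have hmem := Nat.sInf_mem (s := {a | ∀ y, G x y → c₀ y < c₀ x → col (c₀ x) y ≠ a})
      ((hfree' (c₀ x) x).imp fun a => And.right)
    rw [hcolS _ x, if_pos rfl, ← hstab y _ hlt]
    exact hmem y hxy hlt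
  refine ⟨fun x => col (c₀ x + 1) x, ?_, fun x => ?_, fun x y hxy he => ?_⟩
  · have : Measurable fun q : ℕ × X => col q.1 q.2 := measurable_from_prod_countable_right hcolm
    exact this.comp ((hc₀.add_const 1).prodMk measurable_id)
  · obtain ⟨a, ha, H⟩ := hfree' (c₀ x) x
    simp only [hcolS, if_true]
    exact (Nat.sInf_le (s := {a | ∀ y, G x y → c₀ y < c₀ x → col (c₀ x) y ≠ a}) H).trans ha
  · rcases lt_or_gt_of_ne (hne x y hxy) with hlt | hlt
    · exact hspec y x (hsymm _ _ hxy) hlt he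
    · exact hspec x y hxy hlt he.symm

/-- A finite Borel equivalence relation has a Borel selector. -/
theorem exists_selector (h : GeneratedBy E φ) {R : X → X → Prop}
    (hR : Measurable fun q : X × X => R q.1 q.2) (hReq : Equivalence R)
    (hRE : ∀ x y, R x y → E x y) (hfin : ∀ x, {y | R x y}.Finite) :
    ∃ t : X → X, Measurable t ∧ (∀ x, R x (t x)) ∧ ∀ x y, R x y → t x = t y := by
  let e := embeddingReal X
  have he : MeasurableEmbedding e := measurableEmbedding_embeddingReal X
  have hRφ : ∀ n, Measurable fun x => R x (φ n x) := fun n =>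
    hR.comp (measurable_id.prodMk (h.measurable n))
  have hex : ∀ x, ∃ k, R x (φ k x) ∧ ∀ n, R x (φ n x) → e (φ k x) ≤ e (φ n x) := by
    intro x
    obtain ⟨y, hy, hmin⟩ := Set.exists_min_image {y | R x y} e (hfin x) ⟨x, hReq.refl x⟩
    obtain ⟨k, rfl⟩ := (h.iff x y).1 (hRE _ _ hy)
    exact ⟨k, hy, fun n hn => hmin _ hn⟩
  let k : X → ℕ := fun x => sInf {k | R x (φ k x) ∧ ∀ n, R x (φ n x) → e (φ k x) ≤ e (φ n x)}
  have hk : Measurable k := measurable_sInf_nat (fun k => (hRφ k).and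
    (Measurable.forall fun n => (hRφ n).imp (measurableSet_setOfPred.1 (measurableSet_le
      (he.measurable.comp (h.measurable k)) (he.measurable.comp (h.measurable n)))))) hex
  have hspec : ∀ x, R x (φ (k x) x) ∧ ∀ n, R x (φ n x) → e (φ (k x) x) ≤ e (φ n x) :=
    fun x => Nat.sInf_mem (hex x)
  have hle : ∀ x y, R x y → e (φ (k x) x) ≤ e (φ (k y) y) := by
    intro x y hxy
    have hxy' := hReq.trans hxy (hspec y).1
    obtain ⟨n, hn⟩ := (h.iff _ _).1 (hRE _ _ hxy')
    rw [← hn] at hxy' ⊢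
    exact (hspec x).2 n hxy'
  refine ⟨fun x => φ (k x) x, ?_, fun x => (hspec x).1, fun x y hxy => he.injective ?_⟩
  · have : Measurable fun q : ℕ × X => φ q.1 q.2 := measurable_from_prod_countable_right h.measurable
    exact this.comp (hk.prodMk measurable_id)
  · exact le_antisymm (hle x y hxy) (hle y x (hReq.symm hxy))

end GeneratedBy

end Generated

section Stages

variable {X : Type*} [MeasurableSpace X]

/-- `R` is a finite Borel equivalence relation contained in `E` and in the kernel of `f`. -/
structure IsFiniteSub (E : X → X → Prop) (f : X → ℕ) (R : X → X → Prop) : Prop where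
  measurable : Measurable fun q : X × X => R q.1 q.2
  equiv : Equivalence R
  le : ∀ x y, R x y → E x y
  map_eq : ∀ x y, R x y → f x = f y
  finite : ∀ x, {y | R x y}.Finite

/-- A finite stage of the construction: a countable Borel partition `f` on whose pieces `E` is
still aperiodic, and a finite Borel equivalence relation `R` inside it whose classes have at most
`N` elements outside a Borel set `S` that contains at most one `R`-class of each `E ∩ ker f`-class.
-/
structure IsStage (E : X → X → Prop) (f : X → ℕ) (R : X → X → Prop) (S : X → Prop) (N : ℕ) : Prop
    extends IsFiniteSub E f R where
  measurable_map : Measurable f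
  infinite : ∀ x, {y | E x y ∧ f x = f y}.Infinite
  measurable_special : Measurable S
  special_of_rel : ∀ x y, R x y → S x → S y
  rel_of_special : ∀ x y, S x → S y → E x y → f x = f y → R x y
  ncard_le : ∀ x, ¬ S x → {y | R x y}.ncard ≤ N

variable {E : X → X → Prop} {φ : ℕ → X → X} {f : X → ℕ} {R : X → X → Prop} {S : X → Prop} {N : ℕ}

variable [StandardBorelSpace X]

/-- Gluing all the points of a class which lie in a set `M` that is finite on each class. -/
theorem IsFiniteSub.isStage_glue (h : GeneratedBy E φ) (hR : IsFiniteSub E f R) (hf : Measurable f)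
    (hinf : ∀ x, {y | E x y ∧ f x = f y}.Infinite) {M : X → Prop} (hM : Measurable M)
    (hMinv : ∀ x y, R x y → M x → M y) (hMfin : ∀ x, {y | (E x y ∧ f x = f y) ∧ M y}.Finite)
    (hN : ∀ x, ¬ M x → {y | R x y}.ncard ≤ N) :
    IsStage E f (fun x y => R x y ∨ (M x ∧ M y ∧ E x y ∧ f x = f y)) M N where
  measurable := by
    have h1 := hR.measurable
    have h2 := h.measurable_rel
    have h3 : Measurable fun q : X × X => f q.1 = f q.2 := measurableSet_setOfPred.1
      (measurableSet_eq_fun (hf.comp measurable_fst) (hf.comp measurable_snd))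
    have h4 : Measurable fun q : X × X => M q.1 := hM.comp measurable_fst
    have h5 : Measurable fun q : X × X => M q.2 := hM.comp measurable_snd
    exact h1.or (h4.and (h5.and (h2.and h3)))
  equiv := by
    refine ⟨fun x => Or.inl (hR.equiv.refl x), ?_, ?_⟩
    · rintro x y (hxy | ⟨hx, hy, hE, he⟩)
      · exact Or.inl (hR.equiv.symm hxy)
      · exact Or.inr ⟨hy, hx, h.equiv.symm hE, he.symm⟩
    · rintro x y z (hxy | ⟨hx, hy, hE, he⟩) (hyz | ⟨hy', hz, hE', he'⟩)
      · exact Or.inl (hR.equiv.trans hxy hyz)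
      · exact Or.inr ⟨hMinv _ _ (hR.equiv.symm hxy) hy', hz, h.equiv.trans (hR.le _ _ hxy) hE',
          (hR.map_eq _ _ hxy).trans he'⟩
      · exact Or.inr ⟨hx, hMinv _ _ hyz hy, h.equiv.trans hE (hR.le _ _ hyz),
          he.trans (hR.map_eq _ _ hyz)⟩
      · exact Or.inr ⟨hx, hz, h.equiv.trans hE hE', he.trans he'⟩
  le := by
    rintro x y (hxy | hxy)
    exacts [hR.le _ _ hxy, hxy.2.2.1]
  map_eq := by
    rintro x y (hxy | hxy)
    exacts [hR.map_eq _ _ hxy, hxy.2.2.2]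
  finite := by
    intro x
    refine ((hR.finite x).union (hMfin x)).subset ?_
    rintro y (hxy | hxy)
    exacts [Or.inl hxy, Or.inr ⟨hxy.2.2, hxy.2.1⟩]
  measurable_map := hf
  infinite := hinf
  measurable_special := hM
  special_of_rel := by
    rintro x y (hxy | hxy) hx
    exacts [hMinv _ _ hxy hx, hxy.2.1]
  rel_of_special := fun x y hx hy hE he => Or.inr ⟨hx, hy, hE, he⟩
  ncard_le := by
    intro x hx
    convert hN x hx using 3 with y
    simp [hx]

/-- Refining the partition of a stage so that each pair `x, φ p x` is either separated by it or
identified by the finite relation. -/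
theorem IsStage.exists_resolve (h : GeneratedBy E φ) (hS : IsStage E f R S N) (p : ℕ) :
    ∃ f' R' S', IsStage E f' R' S' N ∧ (∀ x y, f' x = f' y → f x = f y) ∧
      (∀ x y, R x y → R' x y) ∧ ∀ x, f' x = f' (φ p x) → R' x (φ p x) := by
  classical
  obtain ⟨t, ht, hRt, htR⟩ := h.exists_selector hS.measurable hS.equiv hS.le hS.finite
  have htt : ∀ x, t (t x) = t x := fun x => (htR _ _ (hRt x)).symm
  have hRiff : ∀ x y, t x = t y → R x y := fun x y he =>
    hS.equiv.trans (hRt x) (he ▸ hS.equiv.symm (hRt y))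
  have hEφ : ∀ x, E x (φ p x) := fun x => (h.iff _ _).2 ⟨p, rfl⟩
  have hφ := h.measurable p
  have hf := hS.measurable_map
  have hRm : ∀ {α : Type _} [MeasurableSpace α] {u v : α → X}, Measurable u → Measurable v →
      Measurable fun a => R (u a) (v a) := fun hu hv => hS.measurable.comp (hu.prodMk hv)
  obtain ⟨c₁, hc₁, hc₁N, hc₁G⟩ := h.exists_bounded_coloring (N := N)
    (G := fun s u => (t s = s ∧ t u = u ∧ ¬ S s ∧ ¬ S u ∧ s ≠ u) ∧
      ∃ z, E s z ∧ (R s z ∧ R u (φ p z))) (by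
      refine Measurable.and ?_ (h.measurable_exists measurable_fst
        (P := fun (q : X × X) z => R q.1 z ∧ R q.2 (φ p z)) ?_)
      · have hs : Measurable fun s => t s = s := measurableSet_setOfPred.1
          (measurableSet_eq_fun ht measurable_id)
        have hSm := hS.measurable_special
        have heq : Measurable fun q : X × X => q.1 = q.2 := measurableSet_setOfPred.1
          (measurableSet_eq_fun measurable_fst measurable_snd)
        exact (hs.comp measurable_fst).and ((hs.comp measurable_snd).and
          ((hSm.comp measurable_fst).not.and ((hSm.comp measurable_snd).not.and heq.not)))
      · exact (hRm (measurable_fst.comp measurable_fst) measurable_snd).and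
          (hRm (measurable_snd.comp measurable_fst) (hφ.comp measurable_snd)))
    (by
      rintro s u ⟨-, z, hz, -, hu⟩
      exact h.equiv.trans hz (h.equiv.trans (hEφ z) (h.equiv.symm (hS.le _ _ hu))))
    (by
      rintro s u ⟨⟨h1, h2, h3, h4, h5⟩, z, hz, hsz, huz⟩
      refine ⟨⟨h2, h1, h4, h3, h5.symm⟩, φ p z, hS.le _ _ huz, huz, ?_⟩
      rwa [h.involutive])
    (fun s hs => hs.1.2.2.2.2 rfl)
    (fun s => ((hS.finite s).image fun z => t (φ p z)).subset (by
      rintro u ⟨⟨h1, h2, h3, h4, h5⟩, z, hz, hsz, huz⟩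
      exact ⟨z, hsz, (htR _ _ huz).symm.trans h2⟩))
    (fun s => by
      by_cases hs : S s
      · simp [hs]
      · refine (Set.ncard_le_ncard ?_ ((hS.finite s).image fun z => t (φ p z))).trans
          ((Set.ncard_image_le (hS.finite s)).trans (hS.ncard_le s hs))
        rintro u ⟨⟨h1, h2, h3, h4, h5⟩, z, hz, hsz, huz⟩
        exact ⟨z, hsz, (htR _ _ huz).symm.trans h2⟩)
  let c : X → ℕ := fun x => if S x then 0 else c₁ (t x) + 1
  have hc : Measurable c := Measurable.ite (measurableSet_setOfPred.2 hS.measurable_special)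
    measurable_const ((hc₁.comp ht).add_const 1)
  have hcN : ∀ x, c x < N + 2 := by
    intro x
    have := hc₁N (t x)
    simp only [c]
    split_ifs <;> omega
  have hcR : ∀ x y, R x y → c x = c y := by
    intro x y hxy
    have : S x ↔ S y := ⟨hS.special_of_rel _ _ hxy, hS.special_of_rel _ _ (hS.equiv.symm hxy)⟩
    simp only [c, this, htR _ _ hxy]
  have hcφ : ∀ x, ¬ S x → ¬ S (φ p x) → c x = c (φ p x) → R x (φ p x) := by
    intro x hx hx' he
    by_contra hn
    have hxt := hS.le _ _ (hS.equiv.symm (hRt x))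
    refine hc₁G (t x) (t (φ p x)) ⟨⟨htt _, htt _, ?_, ?_, ?_⟩, x, hxt, ?_, ?_⟩ ?_
    · exact fun H => hx (hS.special_of_rel _ _ (hS.equiv.symm (hRt x)) H)
    · exact fun H => hx' (hS.special_of_rel _ _ (hS.equiv.symm (hRt _)) H)
    · exact fun H => hn (hRiff _ _ H)
    · exact hS.equiv.symm (hRt x)
    · exact hS.equiv.symm (hRt _)
    · simpa [c, hx, hx'] using he
  let K : X → Prop := fun x => {y | E x y ∧ (f x = f y ∧ c x = c y)}.Finite
  have hfeq : Measurable fun q : X × X => f q.1 = f q.2 := measurableSet_setOfPred.1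
    (measurableSet_eq_fun (hf.comp measurable_fst) (hf.comp measurable_snd))
  have hK : Measurable K := h.measurable_finite (P := fun x y => f x = f y ∧ c x = c y)
    (hfeq.and (measurableSet_setOfPred.1
      (measurableSet_eq_fun (hc.comp measurable_fst) (hc.comp measurable_snd))))
  have hKinv : ∀ x y, E x y → f x = f y → c x = c y → K x → K y := by
    intro x y hE he hce hx
    refine Set.Finite.subset hx ?_
    rintro z ⟨h1, h2, h3⟩
    exact ⟨h.equiv.trans hE h1, he.trans h2, hce.trans h3⟩
  have hKR : ∀ x y, R x y → K x → K y := fun x y hxy =>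
    hKinv x y (hS.le _ _ hxy) (hS.map_eq _ _ hxy) (hcR _ _ hxy)
  have hSK : ∀ x, S x → K x := by
    intro x hx
    refine (hS.finite x).subset ?_
    rintro y ⟨h1, h2, h3⟩
    refine hS.rel_of_special x y hx ?_ h1 h2
    by_contra hy
    simp [c, hx, hy] at h3
  have hKfin : ∀ x, {y | (E x y ∧ f x = f y) ∧ K y}.Finite := by
    intro x
    have : {y | (E x y ∧ f x = f y) ∧ K y} =
        ⋃ a : Fin (N + 2), {y | ((E x y ∧ f x = f y) ∧ K y) ∧ c y = a} := by
      ext y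
      simp only [Set.mem_iUnion, Set.mem_ofPred_eq]
      exact ⟨fun hy => ⟨⟨c y, hcN y⟩, hy, rfl⟩, fun ⟨_, hy, _⟩ => hy⟩
    rw [this]
    refine Set.finite_iUnion fun a => ?_
    rcases Set.eq_empty_or_nonempty {y | ((E x y ∧ f x = f y) ∧ K y) ∧ c y = a} with he | ⟨y, hy⟩
    · rw [he]; exact Set.finite_empty
    · obtain ⟨⟨⟨hxy, hfy⟩, hKy⟩, hcy⟩ := hy
      refine Set.Finite.subset hKy ?_
      rintro z ⟨⟨⟨hxz, hfz⟩, -⟩, hcz⟩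
      exact ⟨h.equiv.trans (h.equiv.symm hxy) hxz, hfy.symm.trans hfz, hcy.trans hcz.symm⟩
  have hdex : ∀ x, ∃ a, ∃ y, E x y ∧ (f x = f y ∧ c y = a ∧ ¬ K y) := by
    intro x
    by_contra hcon
    refine hS.infinite x ((hKfin x).subset fun y hy => ⟨hy, ?_⟩)
    by_contra hKy
    exact hcon ⟨c y, y, hy.1, hy.2, rfl, hKy⟩
  let d : X → ℕ := fun x => sInf {a | ∃ y, E x y ∧ (f x = f y ∧ c y = a ∧ ¬ K y)}
  have hd : Measurable d := measurable_sInf_nat (fun a => h.measurable_exists measurable_id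
    (P := fun x y => f x = f y ∧ c y = a ∧ ¬ K y) (hfeq.and
      (((hc.comp measurable_snd).eq_const a).and (hK.comp measurable_snd).not))) hdex
  have hdspec : ∀ x, ∃ y, E x y ∧ (f x = f y ∧ c y = d x ∧ ¬ K y) := fun x => Nat.sInf_mem (hdex x)
  have hdinv : ∀ x y, E x y → f x = f y → d x = d y := by
    intro x y hE he
    refine congrArg sInf (Set.ext fun a => exists_congr fun z => ?_)
    rw [he]
    exact and_congr_left fun _ => ⟨h.equiv.trans (h.equiv.symm hE), h.equiv.trans hE⟩
  let c' : X → ℕ := fun x => if K x then d x else c x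
  have hc' : Measurable c' := Measurable.ite (measurableSet_setOfPred.2 hK) hd hc
  have hcK : ∀ x, K x → c' x = d x := fun x hx => if_pos hx
  have hcnK : ∀ x, ¬ K x → c' x = c x := fun x hx => if_neg hx
  let f' : X → ℕ := fun x => Nat.pair (f x) (c' x)
  have hf'iff : ∀ x y, f' x = f' y ↔ f x = f y ∧ c' x = c' y := fun x y => Nat.pair_eq_pair
  have hf' : Measurable f' :=
    (measurable_of_countable fun q : ℕ × ℕ => Nat.pair q.1 q.2).comp (hf.prodMk hc')
  have hinf' : ∀ x, {y | E x y ∧ f' x = f' y}.Infinite := by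
    intro x
    obtain ⟨w, hxw, hfw, hcw, hKw⟩ : ∃ w, E x w ∧ f x = f w ∧ c w = c' x ∧ ¬ K w := by
      by_cases hx : K x
      · rw [hcK x hx]; exact hdspec x
      · exact ⟨x, h.equiv.refl x, rfl, (hcnK x hx).symm, hx⟩
    refine Set.Infinite.mono ?_ hKw
    rintro y ⟨h1, h2, h3⟩
    have hKy : ¬ K y := fun hy => hKw (hKinv y w (h.equiv.symm h1) h2.symm h3.symm hy)
    exact ⟨h.equiv.trans hxw h1, (hf'iff _ _).2 ⟨hfw.trans h2, by rw [hcnK y hKy, ← hcw, h3]⟩⟩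
  have hR' : IsFiniteSub E f' R :=
    ⟨hS.measurable, hS.equiv, hS.le, fun x y hxy => (hf'iff _ _).2 ⟨hS.map_eq _ _ hxy, by
      have h1 : K x ↔ K y := ⟨hKR _ _ hxy, hKR _ _ (hS.equiv.symm hxy)⟩
      simp only [c', h1, hdinv _ _ (hS.le _ _ hxy) (hS.map_eq _ _ hxy), hcR _ _ hxy]⟩, hS.finite⟩
  let M : X → Prop := fun y => ∃ z, E y z ∧ (R y z ∧ (K z ∨ (K (φ p z) ∧ f z = f (φ p z))))
  have hM : Measurable M := by
    refine h.measurable_exists measurable_id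
      (P := fun y z => R y z ∧ (K z ∨ (K (φ p z) ∧ f z = f (φ p z)))) ?_
    have h1 : Measurable fun z => K z ∨ (K (φ p z) ∧ f z = f (φ p z)) :=
      hK.or ((hK.comp hφ).and (measurableSet_setOfPred.1 (measurableSet_eq_fun hf (hf.comp hφ))))
    exact hS.measurable.and (h1.comp measurable_snd)
  have hMof : ∀ z, (K z ∨ (K (φ p z) ∧ f z = f (φ p z))) → M z := fun z hz =>
    ⟨z, h.equiv.refl z, hS.equiv.refl z, hz⟩
  refine ⟨f', _, M, hR'.isStage_glue h hf' hinf' hM ?_ ?_ ?_, fun x y he => ((hf'iff _ _).1 he).1,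
    fun x y => Or.inl, fun x he => ?_⟩
  · rintro x y hxy ⟨z, -, hz, H⟩
    have := hS.equiv.trans (hS.equiv.symm hxy) hz
    exact ⟨z, hS.le _ _ this, this, H⟩
  · intro x
    refine ((hKfin x).biUnion (t := fun w => {y | R w y} ∪ {y | R (φ p w) y})
      fun w _ => (hS.finite _).union (hS.finite _)).subset ?_
    rintro y ⟨⟨hxy, hfy⟩, z, hyz, hRyz, H⟩
    have hxz := h.equiv.trans hxy hyz
    have hfz : f x = f z := ((hf'iff _ _).1 hfy).1.trans (hS.map_eq _ _ hRyz)
    rcases H with H | ⟨H, he⟩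
    · exact Set.mem_biUnion (x := z) ⟨⟨hxz, hfz⟩, H⟩ (Or.inl (hS.equiv.symm hRyz))
    · refine Set.mem_biUnion (x := φ p z) ⟨⟨h.equiv.trans hxz (hEφ z), hfz.trans he⟩, H⟩
        (Or.inr ?_)
      simpa [h.involutive] using hS.equiv.symm hRyz
  · exact fun x hx => hS.ncard_le x fun hSx => hx (hMof x (Or.inl (hSK x hSx)))
  · obtain ⟨hfe, hce⟩ := (hf'iff _ _).1 he
    by_cases hx : K x
    · exact Or.inr ⟨hMof _ (Or.inl hx), hMof _ (Or.inr (by rw [h.involutive]; exact ⟨hx, hfe.symm⟩)),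
        hEφ x, he⟩
    by_cases hx' : K (φ p x)
    · exact Or.inr ⟨hMof _ (Or.inr ⟨hx', hfe⟩), hMof _ (Or.inl hx'), hEφ x, he⟩
    · rw [hcnK _ hx, hcnK _ hx'] at hce
      exact Or.inl (hcφ x (fun H => hx (hSK _ H)) (fun H => hx' (hSK _ H)) hce)

/-- Enlarging every class of the finite relation of a stage. -/
theorem IsStage.exists_grow (h : GeneratedBy E φ) (hS : IsStage E f R S N) :
    ∃ R' S', IsStage E f R' S' (N + N) ∧ (∀ x y, R x y → R' x y) ∧ ∀ x, ∃ y, R' x y ∧ ¬ R x y := by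
  classical
  obtain ⟨t, ht, hRt, htR⟩ := h.exists_selector hS.measurable hS.equiv hS.le hS.finite
  have htt : ∀ x, t (t x) = t x := fun x => (htR _ _ (hRt x)).symm
  have hRiff : ∀ x y, t x = t y → R x y := fun x y he =>
    hS.equiv.trans (hRt x) (he ▸ hS.equiv.symm (hRt y))
  have hEt : ∀ x, E x (t x) := fun x => hS.le _ _ (hRt x)
  have hft : ∀ x, f x = f (t x) := fun x => hS.map_eq _ _ (hRt x)
  have hEφ : ∀ p x, E x (φ p x) := fun p x => (h.iff _ _).2 ⟨p, rfl⟩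
  have hφ := h.measurable
  have hf := hS.measurable_map
  have hmeq : ∀ {α : Type _} [MeasurableSpace α] {u v : α → X}, Measurable u → Measurable v →
      Measurable fun a => u a = v a := fun hu hv =>
    measurableSet_setOfPred.1 (measurableSet_eq_fun hu hv)
  have hmeqN : ∀ {α : Type _} [MeasurableSpace α] {u v : α → ℕ}, Measurable u → Measurable v →
      Measurable fun a => u a = v a := fun hu hv =>
    measurableSet_setOfPred.1 (measurableSet_eq_fun hu hv)
  -- `A p` is the set of representatives which are still unmatched before step `p`.
  let A : ℕ → X → Prop := fun p => Nat.rec (fun x => t x = x)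
    (fun p B x => B x ∧ ¬ (B (φ p x) ∧ φ p x ≠ x ∧ f x = f (φ p x))) p
  have hAS : ∀ p x, A (p + 1) x ↔ A p x ∧ ¬ (A p (φ p x) ∧ φ p x ≠ x ∧ f x = f (φ p x)) :=
    fun p x => Iff.rfl
  have hA0 : ∀ x, A 0 x ↔ t x = x := fun x => Iff.rfl
  have hAm : ∀ p, Measurable (A p) := by
    intro p
    induction p with
    | zero => exact hmeq ht measurable_id
    | succ p ih =>
      exact ih.and ((ih.comp (hφ p)).and
        ((hmeq (hφ p) measurable_id).not.and (hmeqN hf (hf.comp (hφ p))))).not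
  have hAanti : ∀ x p q, p ≤ q → A q x → A p x := by
    intro x p q hpq
    induction hpq with
    | refl => exact id
    | step _ ih => exact fun H => ih ((hAS _ _).1 H).1
  have hAt : ∀ x p, A p x → t x = x := fun x p H => hAanti x 0 p (Nat.zero_le p) H
  let Q : X → X → Prop := fun x y => ∃ p, A p x ∧ A p y ∧ φ p x = y ∧ x ≠ y ∧ f x = f y
  have hQm : Measurable fun q : X × X => Q q.1 q.2 :=
    Measurable.exists fun p => ((hAm p).comp measurable_fst).and
      (((hAm p).comp measurable_snd).and ((hmeq ((hφ p).comp measurable_fst) measurable_snd).and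
        ((hmeq measurable_fst measurable_snd).not.and
          (hmeqN (hf.comp measurable_fst) (hf.comp measurable_snd)))))
  have hQsymm : ∀ x y, Q x y → Q y x := by
    rintro x y ⟨p, h1, h2, h3, h4, h5⟩
    exact ⟨p, h2, h1, by rw [← h3, h.involutive], h4.symm, h5.symm⟩
  have hQuniq : ∀ x y z, Q x y → Q x z → y = z := by
    have key : ∀ x y p q, p < q → A p y → φ p x = y → x ≠ y → f x = f y → ¬ A q x := by
      intro x y p q hpq h2 h3 h4 h5 H
      refine ((hAS _ _).1 (hAanti x (p + 1) q hpq H)).2 ?_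
      rw [h3]
      exact ⟨h2, h4.symm, h5⟩
    rintro x y z ⟨p, h1, h2, h3, h4, h5⟩ ⟨q, h1', h2', h3', h4', h5'⟩
    rcases lt_trichotomy p q with hpq | rfl | hpq
    · exact absurd h1' (key x y p q hpq h2 h3 h4 h5)
    · exact h3.symm.trans h3'
    · exact absurd h1 (key x z q p hpq h2' h3' h4' h5')
  have hQE : ∀ x y, Q x y → E x y := fun x y ⟨p, H⟩ => H.2.2.1 ▸ hEφ p x
  let R₂ : X → X → Prop := fun x y => R x y ∨ Q (t x) (t y)
  have hR₂class : ∀ x, ∃ y : X, R₂ x y ∧ {z | R₂ x z} ⊆ {z | R x z} ∪ {z | R y z} := by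
    intro x
    rcases Classical.em (∃ y, Q (t x) (t y)) with ⟨y, hy⟩ | hx
    · refine ⟨y, Or.inr hy, ?_⟩
      rintro z (hz | hz)
      exacts [Or.inl hz, Or.inr (hRiff _ _ (hQuniq _ _ _ hy hz))]
    · refine ⟨x, Or.inl (hS.equiv.refl x), ?_⟩
      rintro z (hz | hz)
      exacts [Or.inl hz, absurd ⟨z, hz⟩ hx]
  have hR₂ : IsFiniteSub E f R₂ := by
    refine ⟨?_, ⟨fun x => Or.inl (hS.equiv.refl x), ?_, ?_⟩, ?_, ?_, fun x => ?_⟩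
    · exact hS.measurable.or
        (hQm.comp ((ht.comp measurable_fst).prodMk (ht.comp measurable_snd)))
    · rintro x y (hxy | hxy)
      exacts [Or.inl (hS.equiv.symm hxy), Or.inr (hQsymm _ _ hxy)]
    · rintro x y z (hxy | hxy) (hyz | hyz)
      · exact Or.inl (hS.equiv.trans hxy hyz)
      · exact Or.inr (by rwa [htR _ _ hxy])
      · exact Or.inr (by rwa [← htR _ _ hyz])
      · exact Or.inl (hRiff _ _ (hQuniq _ _ _ (hQsymm _ _ hxy) hyz))
    · rintro x y (hxy | hxy)
      exacts [hS.le _ _ hxy, h.equiv.trans (hEt x) (h.equiv.trans (hQE _ _ hxy)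
        (h.equiv.symm (hEt y)))]
    · rintro x y (hxy | ⟨-, -, -, -, -, he⟩)
      exacts [hS.map_eq _ _ hxy, (hft x).trans (he.trans (hft y).symm)]
    · obtain ⟨y, -, hy⟩ := hR₂class x
      exact ((hS.finite x).union (hS.finite y)).subset hy
  let L : X → Prop := fun x => ∀ p, A p (t x)
  have hLm : Measurable L := Measurable.forall fun p => (hAm p).comp ht
  have hLR : ∀ x y, L x → L y → E x y → f x = f y → R x y := by
    intro x y hx hy hE he
    by_contra hn
    obtain ⟨p, hp⟩ := (h.iff (t x) (t y)).1
      (h.equiv.trans (h.equiv.symm (hEt x)) (h.equiv.trans hE (hEt y)))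
    refine ((hAS _ _).1 (hx (p + 1))).2 ?_
    rw [hp]
    exact ⟨hy p, fun H => hn (hRiff _ _ H.symm), (hft x).symm.trans (he.trans (hft y))⟩
  have hkex : ∀ z, ∃ k, f (φ k (t z)) = f z ∧ ¬ R z (φ k (t z)) := by
    intro z
    obtain ⟨y, ⟨hy, hfy⟩, hn⟩ := (hS.infinite z).exists_notMem_finite (hS.finite z)
    obtain ⟨k, rfl⟩ := (h.iff (t z) y).1 (h.equiv.trans (h.equiv.symm (hEt z)) hy)
    exact ⟨k, hfy.symm, hn⟩
  let k : X → ℕ := fun z => sInf {k | f (φ k (t z)) = f z ∧ ¬ R z (φ k (t z))}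
  have hkm : Measurable k := measurable_sInf_nat (fun k =>
    (hmeqN (hf.comp ((hφ k).comp ht)) hf).and
      (hS.measurable.comp (measurable_id.prodMk ((hφ k).comp ht))).not) hkex
  have hkspec : ∀ z, f (φ (k z) (t z)) = f z ∧ ¬ R z (φ (k z) (t z)) := fun z =>
    Nat.sInf_mem (hkex z)
  let π : X → X := fun z => φ (k z) (t z)
  have hπm : Measurable π := by
    have : Measurable fun q : ℕ × X => φ q.1 q.2 := measurable_from_prod_countable_right hφ
    exact this.comp (hkm.prodMk ht)
  have hπE : ∀ z, E z (π z) := fun z => h.equiv.trans (hEt z) (hEφ _ _)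
  have hπR : ∀ y z, R y z → π y = π z := by
    intro y z hyz
    have hk : k y = k z := by
      refine congrArg sInf (Set.ext fun a => ?_)
      simp only [Set.mem_ofPred_eq, htR _ _ hyz, hS.map_eq _ _ hyz]
      exact and_congr_right fun _ => not_congr
        ⟨hS.equiv.trans (hS.equiv.symm hyz), hS.equiv.trans hyz⟩
    simp only [π, hk, htR _ _ hyz]
  let W : X → Prop := fun y => ∃ z, E y z ∧ (L z ∧ f z = f y ∧ π z = y)
  have hWm : Measurable W := h.measurable_exists measurable_id
    (P := fun y z => L z ∧ f z = f y ∧ π z = y) ((hLm.comp measurable_snd).and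
      ((hmeqN (hf.comp measurable_snd) (hf.comp measurable_fst)).and
        (hmeq (hπm.comp measurable_snd) measurable_fst)))
  let C : X → Prop := fun z => S z ∨ L z ∨ W z
  have hCm : Measurable C := hS.measurable_special.or (hLm.or hWm)
  have hCfin : ∀ x, {y | (E x y ∧ f x = f y) ∧ C y}.Finite := by
    intro x
    have hone : ∀ P : X → Prop, (∀ y z, P y → P z → E y z → f y = f z → R y z) →
        {y | (E x y ∧ f x = f y) ∧ P y}.Finite := by
      intro P hP
      rcases Set.eq_empty_or_nonempty {y | (E x y ∧ f x = f y) ∧ P y} with he | ⟨y, ⟨hy, hfy⟩, hPy⟩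
      · rw [he]; exact Set.finite_empty
      · refine (hS.finite y).subset ?_
        rintro z ⟨⟨hz, hfz⟩, hPz⟩
        exact hP y z hPy hPz (h.equiv.trans (h.equiv.symm hy) hz) (hfy.symm.trans hfz)
    refine ((hone S hS.rel_of_special).union ((hone L hLR).union (hone W ?_))).subset ?_
    · rintro y z ⟨y', hyy', hLy, hfy, rfl⟩ ⟨z', hzz', hLz, hfz, rfl⟩ hE he
      rw [hπR y' z' (hLR _ _ hLy hLz (h.equiv.trans (h.equiv.symm hyy') (h.equiv.trans hE hzz'))
        (hfy.trans (he.trans hfz.symm)))]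
      exact hS.equiv.refl _
    · rintro y ⟨hy, hC | hC | hC⟩
      exacts [Or.inl ⟨hy, hC⟩, Or.inr (Or.inl ⟨hy, hC⟩), Or.inr (Or.inr ⟨hy, hC⟩)]
  let M : X → Prop := fun y => ∃ z, E y z ∧ (R₂ y z ∧ C z)
  have hM : Measurable M := h.measurable_exists measurable_id (P := fun y z => R₂ y z ∧ C z)
    (hR₂.measurable.and (hCm.comp measurable_snd))
  have hMof : ∀ z, C z → M z := fun z hz => ⟨z, h.equiv.refl z, hR₂.equiv.refl z, hz⟩
  refine ⟨_, M, hR₂.isStage_glue h hf hS.infinite hM ?_ ?_ ?_, fun x y hxy => Or.inl (Or.inl hxy),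
    fun x => ?_⟩
  · rintro x y hxy ⟨z, -, hz, H⟩
    have := hR₂.equiv.trans (hR₂.equiv.symm hxy) hz
    exact ⟨z, hR₂.le _ _ this, this, H⟩
  · intro x
    refine ((hCfin x).biUnion (t := fun w => {y | R₂ w y}) fun w _ => hR₂.finite _).subset ?_
    rintro y ⟨⟨hxy, hfy⟩, z, hyz, hRyz, H⟩
    exact Set.mem_biUnion (x := z) ⟨⟨h.equiv.trans hxy hyz, hfy.trans (hR₂.map_eq _ _ hRyz)⟩, H⟩
      (hR₂.equiv.symm hRyz)
  · intro x hx
    obtain ⟨y, hxy, hy⟩ := hR₂class x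
    refine (Set.ncard_le_ncard hy ((hS.finite x).union (hS.finite y))).trans
      ((Set.ncard_union_le _ _).trans (add_le_add (hS.ncard_le x ?_) (hS.ncard_le y ?_)))
    · exact fun H => hx (hMof x (Or.inl H))
    · exact fun H => hx ⟨y, hR₂.le _ _ hxy, hxy, Or.inl H⟩
  · rcases Classical.em (L x) with hx | hx
    · exact ⟨π x, Or.inr ⟨hMof _ (Or.inr (Or.inl hx)), hMof _ (Or.inr (Or.inr
        ⟨x, h.equiv.symm (hπE x), hx, (hkspec x).1.symm, rfl⟩)), hπE x, (hkspec x).1.symm⟩,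
        (hkspec x).2⟩
    · obtain ⟨p, hp, hp'⟩ : ∃ p, A p (t x) ∧ ¬ A (p + 1) (t x) := by
        by_contra hcon
        push Not at hcon
        exact hx fun p => Nat.rec (motive := fun p => A p (t x)) ((hA0 _).2 (htt x)) hcon p
      rw [hAS, not_and_not_right] at hp'
      obtain ⟨h1, h2, h3⟩ := hp' hp
      have h4 := hAt _ _ h1
      refine ⟨φ p (t x), Or.inl (Or.inr ⟨p, hp, ?_⟩), fun H => h2 ?_⟩
      · rw [h4]
        exact ⟨h1, rfl, h2.symm, h3⟩
      · exact h4.symm.trans (htR _ _ H).symm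

end Stages

/-- An aperiodic relation generated by Borel involutions contains an increasing sequence of finite
Borel equivalence relations with strictly growing classes, whose union is the intersection with the
kernel of a countable family of Borel functions. -/
theorem GeneratedBy.exists_sequence {X : Type*} [MeasurableSpace X] [StandardBorelSpace X]
    {E : X → X → Prop} {φ : ℕ → X → X} (h : GeneratedBy E φ) (hinf : ∀ x, {y | E x y}.Infinite) :
    ∃ (f : ℕ → X → ℕ) (R : ℕ → X → X → Prop), (∀ n, Measurable (f n)) ∧
      (∀ n, IsFiniteSub E (f n) (R n)) ∧ (∀ n x y, R n x y → R (n + 1) x y) ∧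
      (∀ n x, ∃ y, R (n + 1) x y ∧ ¬ R n x y) ∧
      ∀ x y, (∃ n, R n x y) ↔ E x y ∧ ∀ n, f n x = f n y := by
  let T := {s : (X → ℕ) × (X → X → Prop) × (X → Prop) × ℕ // IsStage E s.1 s.2.1 s.2.2.1 s.2.2.2}
  have hstep : ∀ (p : ℕ) (s : T), ∃ s' : T, (∀ x y, s'.1.1 x = s'.1.1 y → s.1.1 x = s.1.1 y) ∧
      (∀ x y, s.1.2.1 x y → s'.1.2.1 x y) ∧ (∀ x, ∃ y, s'.1.2.1 x y ∧ ¬ s.1.2.1 x y) ∧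
      ∀ x, s'.1.1 x = s'.1.1 (φ p x) → s'.1.2.1 x (φ p x) := by
    rintro p ⟨⟨f, R, S, N⟩, hs⟩
    obtain ⟨f', R', S', hs', hf, hR, hp⟩ := hs.exists_resolve h p
    obtain ⟨R'', S'', hs'', hR', hgrow⟩ := hs'.exists_grow h
    refine ⟨⟨⟨f', R'', S'', N + N⟩, hs''⟩, hf, fun x y H => hR' _ _ (hR _ _ H), fun x => ?_,
      fun x H => hR' _ _ (hp x H)⟩
    obtain ⟨y, hy, hy'⟩ := hgrow x
    exact ⟨y, hy, fun H => hy' (hR _ _ H)⟩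
  choose next hnextf hnextR hgrow hres using hstep
  have hstart : IsStage E (fun _ => 0) (fun x y => x = y) (fun _ => False) 1 :=
    { measurable := measurableSet_setOfPred.1 (measurableSet_eq_fun measurable_fst measurable_snd)
      equiv := eq_equivalence
      le := fun x y hxy => hxy ▸ h.equiv.refl x
      map_eq := fun _ _ _ => rfl
      finite := fun x => (Set.finite_singleton x).subset fun y hy => Eq.symm hy
      measurable_map := measurable_const
      infinite := by simpa using hinf
      measurable_special := measurable_const
      special_of_rel := fun _ _ _ H => H
      rel_of_special := fun _ _ H => H.elim
      ncard_le := fun x _ => by simp }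
  let s : ℕ → T := fun n => Nat.rec ⟨⟨_, _, _, _⟩, hstart⟩ next n
  have hsf : ∀ n x y, (s (n + 1)).1.1 x = (s (n + 1)).1.1 y → (s n).1.1 x = (s n).1.1 y :=
    fun n => hnextf n (s n)
  have hsR : ∀ n x y, (s n).1.2.1 x y → (s (n + 1)).1.2.1 x y := fun n => hnextR n (s n)
  refine ⟨fun n => (s n).1.1, fun n => (s n).1.2.1, fun n => (s n).2.measurable_map,
    fun n => (s n).2.toIsFiniteSub, hsR, fun n => hgrow n (s n), fun x y => ⟨?_, ?_⟩⟩
  · rintro ⟨n, hn⟩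
    refine ⟨(s n).2.le _ _ hn, fun m => ?_⟩
    rcases le_total n m with hnm | hmn
    · refine (s m).2.map_eq _ _ ?_
      induction hnm with
      | refl => exact hn
      | step _ ih => exact hsR _ _ _ ih
    · exact Nat.decreasingInduction (motive := fun m _ => (s m).1.1 x = (s m).1.1 y)
        (fun m _ => hsf m x y) ((s n).2.map_eq _ _ hn) hmn
  · rintro ⟨hE, hf⟩
    obtain ⟨p, rfl⟩ := (h.iff _ _).1 hE
    exact ⟨p + 1, hres p (s p) x (hf (p + 1))⟩

/-- For every aperiodic countable Borel equivalence relation `E` on a standard Borel space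
there is a smooth Borel equivalence relation `F` such that `E ∩ F` is aperiodic and
hyperfinite. -/
theorem exists_smooth_with_aperiodic_hyperfinite_intersection
    {X : Type*} [MeasurableSpace X] [StandardBorelSpace X]
    (E : Set (X × X)) (hE : IsCtblBorelEqvRel E)
    (haper : ∀ x : X, {y | (x, y) ∈ E}.Infinite) :
    ∃ F : Set (X × X), SmoothRel F ∧
      (∀ x : X, {y | (x, y) ∈ E ∩ F}.Infinite) ∧
      Hyperfinite (E ∩ F) := by
  obtain ⟨φ, hφm, hφi, hφ⟩ := exists_involutions_of_isCtblBorelEqvRel E hE.1 hE.2.1 hE.2.2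
  have h : GeneratedBy (fun x y => (x, y) ∈ E) φ := ⟨hφm, hφi, hE.2.1, hφ⟩
  obtain ⟨f, R, hf, hR, hmono, hgrow, hunion⟩ := h.exists_sequence haper
  have hunion' : ⋃ n, {q : X × X | R n q.1 q.2} = E ∩ {q | ∀ n, f n q.1 = f n q.2} := by
    ext ⟨x, y⟩
    simpa using hunion x y
  refine ⟨{q | ∀ n, f n q.1 = f n q.2}, ⟨fun x => embeddingReal (ℕ → ℕ) fun n => f n x, ?_, ?_⟩,
    fun x => ?_, fun n => {q | R n q.1 q.2}, ?_, fun n => ⟨?_, (hR n).equiv, (hR n).finite⟩, hunion'⟩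
  · exact (measurableEmbedding_embeddingReal (ℕ → ℕ)).measurable.comp (measurable_pi_lambda _ hf)
  · intro x y
    rw [(measurableEmbedding_embeddingReal (ℕ → ℕ)).injective.eq_iff, funext_iff]
    rfl
  · intro hfin
    rw [← hunion'] at hfin
    have hsub : ∀ n, {y | R n x y} ⊆ {y | (x, y) ∈ ⋃ n, {q : X × X | R n q.1 q.2}} :=
      fun n y hy => Set.mem_iUnion.2 ⟨n, hy⟩
    have hcard : ∀ n, n ≤ {y | R n x y}.ncard := by
      intro n
      induction n with
      | zero => exact Nat.zero_le _
      | succ n ih =>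
        obtain ⟨y, hy, hy'⟩ := hgrow n x
        exact Nat.succ_le_of_lt (ih.trans_lt (Set.ncard_lt_ncard
          ⟨fun z hz => hmono n x z hz, fun H => hy' (H hy)⟩ ((hR (n + 1)).finite x)))
    exact absurd ((hcard _).trans (Set.ncard_le_ncard (hsub _) hfin)) (Nat.not_succ_le_self _)
  · exact monotone_nat_of_le_succ fun n q hq => hmono n _ _ hq
  · exact measurableSet_setOfPred.2 (hR n).measurable
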